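/- Let A(Γ₀) be a dihedral Artin-Tits group with m < ∞ and generating set S = {s,t}, and let w be an unsigned critical word. Then w →_{2⋆} τ(w). -/

import Mathlib

namespace ArtinTits

open Classical List

variable {S : Type*}

/-- A word over `S ∪ S⁻¹`: a list of letters, each a generator together with a sign
(`true` = the generator itself, `false` = its formal inverse). -/
abbrev Word (S : Type*) := List (S × Bool)

/-- The formal inverse of a word. -/
def wordInv (w : Word S) : Word S := w.reverse.map fun l => (l.1, !l.2)

/-- `[x,y,j⟩`: the alternating positive word `xyxy⋯` with `j` letters, beginning with `x`. -/
def altWord (x y : S) : ℕ → Word S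
  | 0 => []
  | j + 1 => (x, true) :: altWord y x j

/-- `⟨x,y,j]`: the alternating positive word `⋯xy` with `j` letters, ending with `y`. -/
def altWordR (x y : S) (j : ℕ) : Word S := (altWord y x j).reverse

/-- The data of a labelled finite complete simplicial graph `Γ₀`: a symmetric label map
with values in `{2,3,…} ∪ {∞}` on pairs of distinct vertices. -/
structure ArtinData (S : Type*) where
  m : S → S → ℕ∞
  symm : ∀ s t, m s t = m t s
  two_le : ∀ s t : S, s ≠ t → 2 ≤ m s t

/-- `u = v` is a defining (braid) relation of the Artin–Tits presentation. -/
def IsRel (A : ArtinData S) (u v : Word S) : Prop :=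
  ∃ (s t : S) (k : ℕ), s ≠ t ∧ A.m s t = (k : ℕ∞) ∧
    u = altWord s t k ∧ v = altWord t s k

/-- The relator set of the Artin–Tits presentation, inside the free group. -/
def rels (A : ArtinData S) : Set (FreeGroup S) :=
  {x | ∃ u v : Word S, IsRel A u v ∧ x = FreeGroup.mk u * (FreeGroup.mk v)⁻¹}

/-- The Artin–Tits group `A(Γ₀)` of the presentation. -/
abbrev ArtinGroup (A : ArtinData S) := PresentedGroup (rels A)

/-- `w̄`: the element of the Artin–Tits group represented by the word `w`. -/
def wbar (A : ArtinData S) (w : Word S) : ArtinGroup A :=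
  PresentedGroup.mk (rels A) (FreeGroup.mk w)

/-! ### Special transformations -/

/-- Type 0: delete a factor `s s⁻¹` or `s⁻¹ s`. -/
def Step0 (w w' : Word S) : Prop :=
  ∃ (w₁ w₂ : Word S) (s : S) (b : Bool),
    w = w₁ ++ [(s, b), (s, !b)] ++ w₂ ∧ w' = w₁ ++ w₂

/-- Type ∞: insert a factor `s s⁻¹` or `s⁻¹ s` (the inverse of type 0). -/
def StepInfty (w w' : Word S) : Prop := Step0 w' w

/-- Type 1: replace a factor `v` by `u`, or `v⁻¹` by `u⁻¹`, where `u = v` is a defining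
relation. -/
def Step1 (A : ArtinData S) (w w' : Word S) : Prop :=
  ∃ (w₁ w₂ u v : Word S), IsRel A u v ∧
    ((w = w₁ ++ v ++ w₂ ∧ w' = w₁ ++ u ++ w₂) ∨
     (w = w₁ ++ wordInv v ++ w₂ ∧ w' = w₁ ++ wordInv u ++ w₂))

/-- Type 2r: for a defining relation `u₁u₂ = v₁v₂` with `u₁, v₁` non-empty, replace a factor
`v₁⁻¹ u₁` by `v₂ u₂⁻¹`. -/
def Step2r (A : ArtinData S) (w w' : Word S) : Prop :=
  ∃ (w₁ w₂ u₁ u₂ v₁ v₂ : Word S), IsRel A (u₁ ++ u₂) (v₁ ++ v₂) ∧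
    u₁ ≠ [] ∧ v₁ ≠ [] ∧
    w = w₁ ++ wordInv v₁ ++ u₁ ++ w₂ ∧ w' = w₁ ++ v₂ ++ wordInv u₂ ++ w₂

/-- Type 2l: for a defining relation `u₁u₂ = v₁v₂` with `u₂, v₂` non-empty, replace a factor
`v₂ u₂⁻¹` by `v₁⁻¹ u₁`. -/
def Step2l (A : ArtinData S) (w w' : Word S) : Prop :=
  ∃ (w₁ w₂ u₁ u₂ v₁ v₂ : Word S), IsRel A (u₁ ++ u₂) (v₁ ++ v₂) ∧
    u₂ ≠ [] ∧ v₂ ≠ [] ∧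
    w = w₁ ++ v₂ ++ wordInv u₂ ++ w₂ ∧ w' = w₁ ++ wordInv v₁ ++ u₁ ++ w₂

/-- Type 2: a type 2r or type 2l transformation. -/
def Step2 (A : ArtinData S) (w w' : Word S) : Prop := Step2r A w w' ∨ Step2l A w w'

/-- `p` is the greatest (longest) common left factor of `x` and `y`. -/
def IsLCPrefix (p x y : Word S) : Prop :=
  p <+: x ∧ p <+: y ∧ ∀ q : Word S, q <+: x → q <+: y → q.length ≤ p.length

/-- `p` is the greatest (longest) common right factor of `x` and `y`. -/
def IsLCSuffix (p x y : Word S) : Prop :=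
  p <:+ x ∧ p <:+ y ∧ ∀ q : Word S, q <:+ x → q <:+ y → q.length ≤ p.length

/-- Type 2r⋆ : a type 2r transformation `w₁ v⁻¹ v' w₂ → w₁ u (u')⁻¹ w₂` (with `vu = v'u'` a
defining relation) such that `v` is the greatest common left factor of `vu` and `v w₁⁻¹`, and
`v'` is the greatest common left factor of `v'u'` and `v' w₂`. -/
def Step2rStar (A : ArtinData S) (w w' : Word S) : Prop :=
  ∃ (w₁ w₂ v u v' u' : Word S), IsRel A (v ++ u) (v' ++ u') ∧
    v ≠ [] ∧ v' ≠ [] ∧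
    w = w₁ ++ wordInv v ++ v' ++ w₂ ∧
    w' = w₁ ++ u ++ wordInv u' ++ w₂ ∧
    IsLCPrefix v (v ++ u) (v ++ wordInv w₁) ∧
    IsLCPrefix v' (v' ++ u') (v' ++ w₂)

/-- Type 2l⋆ : a type 2l transformation `w₁ v (v')⁻¹ w₂ → w₁ u⁻¹ u' w₂` (with `uv = u'v'` a
defining relation) such that `v` is the greatest common right factor of `uv` and `w₁ v`, and
`v'` is the greatest common right factor of `u'v'` and `w₂⁻¹ v'`. -/
def Step2lStar (A : ArtinData S) (w w' : Word S) : Prop :=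
  ∃ (w₁ w₂ v u v' u' : Word S), IsRel A (u ++ v) (u' ++ v') ∧
    v ≠ [] ∧ v' ≠ [] ∧
    w = w₁ ++ v ++ wordInv v' ++ w₂ ∧
    w' = w₁ ++ wordInv u ++ u' ++ w₂ ∧
    IsLCSuffix v (u ++ v) (w₁ ++ v) ∧
    IsLCSuffix v' (u' ++ v') (wordInv w₂ ++ v')

/-- Type 2⋆ : a type 2r⋆ or type 2l⋆ transformation. -/
def Step2Star (A : ArtinData S) (w w' : Word S) : Prop :=
  Step2rStar A w w' ∨ Step2lStar A w w'

/-- `w →_{0,1,2} w'`. -/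
def Steps012 (A : ArtinData S) : Word S → Word S → Prop :=
  Relation.ReflTransGen fun x y => Step0 x y ∨ Step1 A x y ∨ Step2 A x y

/-- `w →_{0,1,2⋆} w'`. -/
def Steps012Star (A : ArtinData S) : Word S → Word S → Prop :=
  Relation.ReflTransGen fun x y => Step0 x y ∨ Step1 A x y ∨ Step2Star A x y

/-- `w →_{2⋆} w'`. -/
def Steps2Star (A : ArtinData S) : Word S → Word S → Prop :=
  Relation.ReflTransGen (Step2Star A)

/-- `w →_{1,2⋆} w'`. -/
def Steps12Star (A : ArtinData S) : Word S → Word S → Prop :=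
  Relation.ReflTransGen fun x y => Step1 A x y ∨ Step2Star A x y

/-- `w →_{1,2} w'`. -/
def Steps12 (A : ArtinData S) : Word S → Word S → Prop :=
  Relation.ReflTransGen fun x y => Step1 A x y ∨ Step2 A x y

/-! ### Classes of words -/

/-- A positive word: written over `S`. -/
def Positive (w : Word S) : Prop := ∀ l ∈ w, l.2 = true

/-- A negative word: written over `S⁻¹`. -/
def Negative (w : Word S) : Prop := ∀ l ∈ w, l.2 = false

/-- A signed word: positive or negative. -/
def Signed (w : Word S) : Prop := Positive w ∨ Negative w

/-- An unsigned word: neither positive nor negative. -/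
def Unsigned (w : Word S) : Prop := ¬ Positive w ∧ ¬ Negative w

/-- A freely reduced word: no factor `s s⁻¹` or `s⁻¹ s`. -/
def FreelyReduced (w : Word S) : Prop :=
  ∀ (w₁ w₂ : Word S) (s : S) (b : Bool), w ≠ w₁ ++ [(s, b), (s, !b)] ++ w₂

/-- A square-free word: no factor `aa`. -/
def SquareFree (w : Word S) : Prop := ∀ a : S × Bool, ¬ [a, a] <:+: w

/-- `p̃(w)`: the length of the longest square-free positive factor of `w`. -/
noncomputable def ptilde (w : Word S) : ℕ :=
  sSup {n | ∃ v : Word S, v <:+: w ∧ Positive v ∧ SquareFree v ∧ v.length = n}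

/-- `ñ(w)`: the length of the longest negative factor of `w` whose formal inverse is
square-free. -/
noncomputable def ntilde (w : Word S) : ℕ :=
  sSup {n | ∃ v : Word S, v <:+: w ∧ Negative v ∧ SquareFree (wordInv v) ∧ v.length = n}

/-- `p(w) = min(p̃(w), m)`. -/
noncomputable def pfun (M : ℕ) (w : Word S) : ℕ := min (ptilde w) M

/-- `n(w) = min(ñ(w), m)`. -/
noncomputable def nfun (M : ℕ) (w : Word S) : ℕ := min (ntilde w) M

/-- `Ω(Γ₀)` (for a dihedral presentation with label `M`): the freely reduced words with
`max(p(w), n(w)) < M`. -/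
def Omega (M : ℕ) (w : Word S) : Prop :=
  FreelyReduced w ∧ max (pfun M w) (nfun M w) < M

/-- A signed square-free word (square-free positive, or negative with square-free inverse). -/
def SignedSF (w : Word S) : Prop :=
  (Positive w ∧ SquareFree w) ∨ (Negative w ∧ SquareFree (wordInv w))

/-- `v` is the maximal square-free signed left factor of `w`. -/
def MaxSignedSFPrefix (v w : Word S) : Prop :=
  v <+: w ∧ SignedSF v ∧ ∀ v' : Word S, v' <+: w → SignedSF v' → v'.length ≤ v.length

/-- `(v₁, …, v_k)` is the `⋆`-decomposition of `w`: the `v_i` are non-empty, `w = v₁⋯v_k`,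
and each `v_i` is the maximal square-free signed left factor of `v_i⋯v_k`. -/
def StarDecomp (w : Word S) (L : List (Word S)) : Prop :=
  w = L.flatten ∧ (∀ v ∈ L, v ≠ ([] : Word S)) ∧
    ∀ i (h : i < L.length), MaxSignedSFPrefix (L.get ⟨i, h⟩) ((L.drop i).flatten)

/-! ### Groups, parabolic subgroups, geodesics -/

/-- A word written over `T ∪ T⁻¹` for a subset `T` of the generators. -/
def WordOver (T : Set S) (w : Word S) : Prop := ∀ l ∈ w, l.1 ∈ T

/-- The standard parabolic subgroup `A_T` generated by the image of `T ⊆ S`. -/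
def parab (A : ArtinData S) (T : Set S) : Subgroup (ArtinGroup A) :=
  Subgroup.closure {x | ∃ s ∈ T, x = wbar A [(s, true)]}

/-- A geodesic word: of minimal length among all words representing the same element. -/
def Geodesic (A : ArtinData S) (w : Word S) : Prop :=
  ∀ w' : Word S, wbar A w' = wbar A w → w.length ≤ w'.length

/-- A word over `T ∪ T⁻¹` that is geodesic among the words over `T ∪ T⁻¹` representing the
same element. -/
def GeodesicOver (A : ArtinData S) (T : Set S) (w : Word S) : Prop :=
  WordOver T w ∧
    ∀ w' : Word S, WordOver T w' → wbar A w' = wbar A w → w.length ≤ w'.length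

/-- The length of a group element: the length of any geodesic representative word. -/
noncomputable def elLength (A : ArtinData S) (g : ArtinGroup A) : ℕ :=
  sInf {n | ∃ w : Word S, wbar A w = g ∧ w.length = n}

/-- A positive element: one represented by a positive word. -/
def IsPosElt (A : ArtinData S) (g : ArtinGroup A) : Prop :=
  ∃ w : Word S, Positive w ∧ wbar A w = g

/-- An `H`-transversal: a subset containing `1` and exactly one element of each left
`H`-coset. -/
def IsLeftTransversal {G : Type*} [Group G] (H : Subgroup G) (T : Set G) : Prop :=
  (1 : G) ∈ T ∧ ∀ g : G, ∃! x, x ∈ T ∧ g⁻¹ * x ∈ H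

/-! ### Properties H, H⁺, H# -/

/-- Property `H`: `w →_{0,1,2} ε ↔ w̄ = 1`. -/
def PropertyH (A : ArtinData S) : Prop :=
  ∀ w : Word S, Steps012 A w [] ↔ wbar A w = 1

/-- Property `H⁺`: every word representing an element of a standard parabolic subgroup
`A_{S₀}` can be transformed by `→_{0,1,2⋆}` into a word over `S₀ ∪ S₀⁻¹`. -/
def PropertyHPlus (A : ArtinData S) : Prop :=
  ∀ (S₀ : Set S) (w : Word S), wbar A w ∈ parab A S₀ →
    ∃ w₀ : Word S, WordOver S₀ w₀ ∧ Steps012Star A w w₀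

/-- Property `H#` with respect to an `S`-sequence of transversals `T`. -/
def PropertyHSharpWrt (A : ArtinData S) (T : Set S → Set (ArtinGroup A)) : Prop :=
  (∀ S₀ : Set S, IsLeftTransversal (parab A S₀) (T S₀)) ∧
    ∀ (S' S₀ : Set S) (w : Word S), wbar A w ∈ parab A S' →
      ∃ v u : Word S, WordOver S' v ∧ WordOver (S' ∩ S₀) u ∧
        Steps012 A w (v ++ u) ∧ wbar A v ∈ T S₀

/-- Property `H#`: property `H#` with respect to some `S`-sequence of transversals. -/
def PropertyHSharp (A : ArtinData S) : Prop :=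
  ∃ T : Set S → Set (ArtinGroup A), PropertyHSharpWrt A T

/-! ### Critical words and the involution τ (relative to a dihedral pair) -/

/-- The permutation `δ` induced by conjugation by `Δ`, extended letterwise to words:
the identity if `M` is even, and the swap of `s` and `t` if `M` is odd. -/
noncomputable def deltaMap (s t : S) (M : ℕ) (w : Word S) : Word S :=
  if Even M then w
  else w.map fun l => (if l.1 = s then t else if l.1 = t then s else l.1, l.2)

/-- `w` is an unsigned critical word (of the dihedral pair `{s,t}` with label `M`) and
`w' = τ(w)`. -/
def UCritTauPair (A : ArtinData S) (s t : S) (M : ℕ) (w w' : Word S) : Prop :=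
  WordOver {s, t} w ∧ FreelyReduced w ∧ Unsigned w ∧ GeodesicOver A {s, t} w ∧
  pfun M w + nfun M w = M ∧
  ∃ (x y z z' : S) (wm : Word S),
    ({x, y} : Set S) = {s, t} ∧ ({z, z'} : Set S) = {s, t} ∧
    ((w = altWord x y (pfun M w) ++ wm ++ wordInv (altWord z z' (nfun M w)) ∧
      w' = wordInv (altWordR x y (nfun M w)) ++ deltaMap s t M wm ++
        altWordR z z' (pfun M w)) ∨
     (w = wordInv (altWordR x y (nfun M w)) ++ wm ++ altWordR z z' (pfun M w) ∧
      w' = altWord x y (pfun M w) ++ deltaMap s t M wm ++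
        wordInv (altWord z z' (nfun M w))))

/-- `w` is a positive critical word (of the dihedral pair `{s,t}` with label `M`) and
`w' = τ(w)`. -/
def PosCritTauPair (A : ArtinData S) (s t : S) (M : ℕ) (w w' : Word S) : Prop :=
  WordOver {s, t} w ∧ Positive w ∧ pfun M w = M ∧
  ∃ (x y : S) (wm : Word S), ({x, y} : Set S) = {s, t} ∧ pfun M wm < M ∧
    ((w = altWord x y M ++ wm ∧
      (w' = deltaMap s t M wm ++ altWordR x y M ∨
       w' = deltaMap s t M wm ++ altWordR y x M) ∧
      w'.getLast? ≠ w.getLast?) ∨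
     (w = wm ++ altWordR x y M ∧
      (w' = altWord x y M ++ deltaMap s t M wm ∨
       w' = altWord y x M ++ deltaMap s t M wm) ∧
      w'.head? ≠ w.head?))

/-- `w` is a negative critical word and `w' = τ(w)` (defined via formal inverses). -/
def NegCritTauPair (A : ArtinData S) (s t : S) (M : ℕ) (w w' : Word S) : Prop :=
  PosCritTauPair A s t M (wordInv w) (wordInv w')

/-- `w` is a critical word (unsigned, positive or negative) and `w' = τ(w)`. -/
def CritTauPair (A : ArtinData S) (s t : S) (M : ℕ) (w w' : Word S) : Prop :=
  UCritTauPair A s t M w w' ∨ PosCritTauPair A s t M w w' ∨ NegCritTauPair A s t M w w'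

/-- A type β transformation relative to the dihedral pair `{s,t}` with label `M`:
replace a critical factor `v` by `τ(v)`. -/
def StepBetaPair (A : ArtinData S) (s t : S) (M : ℕ) (w w' : Word S) : Prop :=
  ∃ (w₁ w₂ v v' : Word S), w = w₁ ++ v ++ w₂ ∧ w' = w₁ ++ v' ++ w₂ ∧
    CritTauPair A s t M v v'

/-- A type β transformation (in an Artin–Tits group): a type β transformation relative to some
dihedral standard parabolic subgroup (a pair of generators with finite label). -/
def StepBeta (A : ArtinData S) (w w' : Word S) : Prop :=
  ∃ (s t : S) (M : ℕ), s ≠ t ∧ A.m s t = (M : ℕ∞) ∧ StepBetaPair A s t M w w'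

/-! ### Restriction, direct products, Coxeter graph notions -/

/-- The Artin–Tits presentation induced on a subset `T` of the generators (the presentation of
the standard parabolic subgroup `A_T`). -/
def ArtinData.restrict (A : ArtinData S) (T : Set S) : ArtinData T where
  m a b := A.m a b
  symm a b := A.symm a b
  two_le a b h := A.two_le a b fun h' => h (Subtype.ext h')

/-- The Artin–Tits presentation on the disjoint union `S₁ ⊕ S₂` obtained from presentations on
`S₁` and `S₂` by adding the commuting relations `s₁s₂ = s₂s₁` (label `2`) for `s₁ ∈ S₁`,
`s₂ ∈ S₂`. -/
def prodData {S₁ S₂ : Type*} (A₁ : ArtinData S₁) (A₂ : ArtinData S₂) :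
    ArtinData (S₁ ⊕ S₂) where
  m x y :=
    match x, y with
    | Sum.inl a, Sum.inl b => A₁.m a b
    | Sum.inr a, Sum.inr b => A₂.m a b
    | _, _ => 2
  symm x y := by
    cases x <;> cases y
    · exact A₁.symm _ _
    · rfl
    · rfl
    · exact A₂.symm _ _
  two_le x y h := by
    cases x <;> cases y
    · exact A₁.two_le _ _ fun h' => h (congrArg Sum.inl h')
    · exact le_rfl
    · exact le_rfl
    · exact A₂.two_le _ _ fun h' => h (congrArg Sum.inr h')

/-- Adjacency in the Coxeter graph `Γ` restricted to `T`: distinct vertices of `T` joined by an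
edge (i.e. with label `≠ 2`, edges labelled `2` being removed in `Γ`). -/
def coxAdj (A : ArtinData S) (T : Set S) (x y : S) : Prop :=
  x ∈ T ∧ y ∈ T ∧ x ≠ y ∧ A.m x y ≠ 2

/-- The full subgraph of the Coxeter graph on the vertex subset `T` is connected. -/
def CoxConnected (A : ArtinData S) (T : Set S) : Prop :=
  ∀ x ∈ T, ∀ y ∈ T, Relation.ReflTransGen (coxAdj A T) x y

/-- The relator set of the Coxeter presentation on `T`: the Artin relations together with the
squares of the generators. -/
def coxRels (A : ArtinData S) (T : Set S) : Set (FreeGroup T) :=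
  rels (A.restrict T) ∪ {g | ∃ x : T, g = FreeGroup.of x * FreeGroup.of x}

/-- The induced presentation on `T` is of spherical type: its Coxeter group is finite. -/
def SphericalType (A : ArtinData S) (T : Set S) : Prop :=
  Finite (PresentedGroup (coxRels A T))

/-- The induced presentation on `T` is of large type: all labels are `≥ 3` (possibly `∞`). -/
def LargeTypeOn (A : ArtinData S) (T : Set S) : Prop :=
  ∀ x ∈ T, ∀ y ∈ T, x ≠ y → 3 ≤ A.m x y

/-! ### Words and formal inverses -/

lemma wordInv_append (u v : Word S) : wordInv (u ++ v) = wordInv v ++ wordInv u := by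
  simp [wordInv]

lemma wordInv_wordInv (u : Word S) : wordInv (wordInv u) = u := by
  simp [wordInv, List.map_reverse, Function.comp_def]

lemma wordInv_reverse (u : Word S) : wordInv u.reverse = (wordInv u).reverse := by
  simp [wordInv]

lemma length_wordInv (u : Word S) : (wordInv u).length = u.length := by
  simp [wordInv]

lemma getLast?_wordInv (u : Word S) :
    (wordInv u).getLast? = u.head?.map fun l => (l.1, !l.2) := by
  simp [wordInv]

lemma isLCSuffix_of_getLast? {u v w : Word S} {a : S × Bool}
    (hu : u.getLast? = some a) (hw : w.getLast? ≠ some a) :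
    IsLCSuffix v (u ++ v) (w ++ v) := by
  refine ⟨List.suffix_append _ _, List.suffix_append _ _, fun q hq₁ hq₂ => ?_⟩
  by_contra! hlt
  obtain ⟨q₀, rfl⟩ := List.suffix_of_suffix_length_le (List.suffix_append u v) hq₁ hlt.le
  rw [List.suffix_append_self_iff] at hq₁ hq₂
  have hne : q₀ ≠ [] := by rintro rfl; simp at hlt
  obtain ⟨c, hc⟩ : ∃ c, q₀.getLast? = some c := ⟨_, List.getLast?_eq_some_getLast hne⟩
  obtain ⟨a₁, rfl⟩ := hq₁
  obtain ⟨a₂, rfl⟩ := hq₂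
  simp_all [List.getLast?_append]

lemma IsLCSuffix.reverse {p x y : Word S} (h : IsLCSuffix p x y) :
    IsLCPrefix p.reverse x.reverse y.reverse := by
  obtain ⟨h₁, h₂, h₃⟩ := h
  refine ⟨List.reverse_prefix.2 h₁, List.reverse_prefix.2 h₂, fun q hx hy => ?_⟩
  have := h₃ q.reverse (by simpa using List.reverse_suffix.2 hx)
    (by simpa using List.reverse_suffix.2 hy)
  simpa using this

/-! ### Alternating words indexed by parity -/

/-- The `k`-th letter of the alternating sequence `s, t, s, t, …`. -/
def letter (s t : S) (k : ℕ) : S := if k % 2 = 0 then s else t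

/-- The positive alternating word of length `j` beginning with `letter s t k`. -/
def alt (s t : S) (k j : ℕ) : Word S := altWord (letter s t k) (letter s t (k + 1)) j

variable {s t : S}

lemma letter_congr {k l : ℕ} (h : k % 2 = l % 2) : letter s t k = letter s t l := by
  simp [letter, h]

lemma letter_inj (hst : s ≠ t) {k l : ℕ} (h : letter s t k = letter s t l) :
    k % 2 = l % 2 := by
  unfold letter at h
  split_ifs at h
  all_goals first | omega | exact absurd h hst | exact absurd h.symm hst

lemma exists_letter (hdih : ∀ x : S, x = s ∨ x = t) (x : S) (c : ℕ) :
    x = letter s t c ∨ x = letter s t (c + 1) := by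
  unfold letter
  rcases hdih x with rfl | rfl <;> rcases Nat.mod_two_eq_zero_or_one c with h | h
  · simp [h]
  · have : (c + 1) % 2 = 0 := by omega
    simp [this]
  · have : (c + 1) % 2 ≠ 0 := by omega
    simp [this]
  · simp [h]

lemma alt_congr {k l : ℕ} (h : k % 2 = l % 2) (j : ℕ) : alt s t k j = alt s t l j := by
  unfold alt
  rw [letter_congr h, letter_congr (show (k + 1) % 2 = (l + 1) % 2 by omega)]

lemma alt_zero (k : ℕ) : alt s t k 0 = [] := rfl

lemma alt_succ (k j : ℕ) : alt s t k (j + 1) = (letter s t k, true) :: alt s t (k + 1) j := by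
  unfold alt
  rw [altWord, letter_congr (show (k + 1 + 1) % 2 = k % 2 by omega)]

lemma alt_one (k : ℕ) : alt s t k 1 = [(letter s t k, true)] := by
  rw [alt_succ, alt_zero]

lemma alt_add (k i j : ℕ) : alt s t k (i + j) = alt s t k i ++ alt s t (k + i) j := by
  induction i generalizing k with
  | zero => simp [alt_zero]
  | succ i ih =>
    rw [show i + 1 + j = (i + j) + 1 by omega, alt_succ, alt_succ, ih,
      show k + (i + 1) = k + 1 + i by omega, List.cons_append]

lemma alt_succ' (k j : ℕ) : alt s t k (j + 1) = alt s t k j ++ [(letter s t (k + j), true)] := by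
  rw [alt_add, alt_one]

lemma length_alt (k j : ℕ) : (alt s t k j).length = j := by
  induction j generalizing k with
  | zero => rfl
  | succ j ih => simp [alt_succ, ih]

lemma alt_ne_nil (k : ℕ) {j : ℕ} (hj : 1 ≤ j) : alt s t k j ≠ [] := by
  intro h
  have := length_alt (s := s) (t := t) k j
  simp [h] at this
  omega

lemma reverse_alt (k j : ℕ) : (alt s t k j).reverse = alt s t (k + j + 1) j := by
  induction j generalizing k with
  | zero => rfl
  | succ j ih =>
    rw [alt_succ', List.reverse_append, ih, alt_succ,
      letter_congr (show (k + (j + 1) + 1) % 2 = (k + j) % 2 by omega),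
      alt_congr (show (k + (j + 1) + 1 + 1) % 2 = (k + j + 1) % 2 by omega)]
    rfl

lemma getLast?_alt (k : ℕ) {j : ℕ} (hj : 1 ≤ j) :
    (alt s t k j).getLast? = some (letter s t (k + j + 1), true) := by
  obtain ⟨j, rfl⟩ := Nat.exists_eq_add_of_le' hj
  rw [alt_succ', List.getLast?_concat,
    letter_congr (show (k + (j + 1) + 1) % 2 = (k + j) % 2 by omega)]

lemma head?_alt (k : ℕ) {j : ℕ} (hj : 1 ≤ j) :
    (alt s t k j).head? = some (letter s t k, true) := by
  obtain ⟨j, rfl⟩ := Nat.exists_eq_add_of_le' hj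
  rw [alt_succ, List.head?_cons]

lemma head?_wordInv_alt (k : ℕ) {j : ℕ} (hj : 1 ≤ j) :
    (wordInv (alt s t k j)).head? = some (letter s t (k + j + 1), false) := by
  simp [wordInv, getLast?_alt k hj]

lemma wordInv_alt_succ (k j : ℕ) :
    wordInv (alt s t k (j + 1)) = (letter s t (k + j), false) :: wordInv (alt s t k j) := by
  rw [alt_succ', wordInv_append]
  rfl

lemma wordInv_alt_one (k : ℕ) : wordInv (alt s t k 1) = [(letter s t k, false)] := by
  rw [wordInv_alt_succ, alt_zero]
  rfl

lemma wordInv_alt_succ' (k j : ℕ) :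
    wordInv (alt s t k (j + 1)) = wordInv (alt s t (k + 1) j) ++ [(letter s t k, false)] := by
  rw [alt_succ]
  simp [wordInv]

lemma wordInv_alt_add (k i j : ℕ) :
    wordInv (alt s t k (i + j)) = wordInv (alt s t (k + i) j) ++ wordInv (alt s t k i) := by
  rw [alt_add, wordInv_append]

lemma positive_alt (k j : ℕ) : Positive (alt s t k j) := by
  induction j generalizing k with
  | zero => simp [Positive, alt_zero]
  | succ j ih =>
    intro l hl
    rw [alt_succ, List.mem_cons] at hl
    rcases hl with rfl | hl
    · rfl
    · exact ih _ l hl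

lemma squareFree_alt (hst : s ≠ t) (k j : ℕ) : SquareFree (alt s t k j) := by
  rintro a ⟨u, v, h⟩
  induction j generalizing k u with
  | zero => simp [alt_zero] at h
  | succ j ih =>
    rw [alt_succ] at h
    cases u with
    | cons b u =>
      simp only [List.cons_append, List.cons.injEq] at h
      exact ih (k + 1) u (by simpa using h.2)
    | nil =>
      simp only [List.nil_append, List.cons_append, List.cons.injEq] at h
      cases j with
      | zero => simp [alt_zero] at h
      | succ j =>
        rw [alt_succ, List.cons.injEq] at h
        have := letter_inj hst (Prod.ext_iff.1 (h.1.symm.trans h.2.1)).1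
        omega

lemma negative_wordInv {w : Word S} (hw : Positive w) : Negative (wordInv w) := by
  intro l hl
  simp only [wordInv, List.mem_map, List.mem_reverse] at hl
  obtain ⟨a, ha, rfl⟩ := hl
  simp [hw a ha]

lemma IsRel.reverse {A : ArtinData S} {u v : Word S} (h : IsRel A u v) :
    IsRel A v.reverse u.reverse := by
  obtain ⟨s, t, k, hst, hk, rfl, rfl⟩ := h
  have e₁ : altWord s t k = alt s t 0 k := rfl
  have e₂ : altWord t s k = alt s t 1 k := rfl
  rw [e₁, e₂, reverse_alt, reverse_alt]
  rcases Nat.mod_two_eq_zero_or_one k with hk2 | hk2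
  · rw [alt_congr (l := 0) (by omega), alt_congr (k := 0 + k + 1) (l := 1) (by omega)]
    exact ⟨s, t, k, hst, hk, rfl, rfl⟩
  · rw [alt_congr (l := 1) (by omega), alt_congr (k := 0 + k + 1) (l := 0) (by omega)]
    exact ⟨t, s, k, hst.symm, (A.symm t s).trans hk, rfl, rfl⟩

lemma Step2lStar.reverse {A : ArtinData S} {w w' : Word S} (h : Step2lStar A w w') :
    Step2rStar A w.reverse w'.reverse := by
  obtain ⟨w₁, w₂, v, u, v', u', hrel, hv, hv', rfl, rfl, h₁, h₂⟩ := h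
  refine ⟨w₂.reverse, w₁.reverse, v'.reverse, u'.reverse, v.reverse, u.reverse, ?_, ?_, ?_,
    ?_, ?_, ?_, ?_⟩
  · simpa using hrel.reverse
  · simpa using hv'
  · simpa using hv
  · simp [wordInv_reverse]
  · simp [wordInv_reverse]
  · simpa [wordInv_reverse] using h₂.reverse
  · simpa [wordInv_reverse] using h₁.reverse

lemma isRel_alt {A : ArtinData S} {M : ℕ} (hst : s ≠ t) (hM : A.m s t = (M : ℕ∞))
    {k l : ℕ} (h : (k + l) % 2 = 1) : IsRel A (alt s t k M) (alt s t l M) := by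
  rcases Nat.mod_two_eq_zero_or_one k with hk | hk
  · rw [alt_congr (l := 0) (by omega), alt_congr (k := l) (l := 1) (by omega)]
    exact ⟨s, t, M, hst, hM, rfl, rfl⟩
  · rw [alt_congr (l := 1) (by omega), alt_congr (k := l) (l := 0) (by omega)]
    exact ⟨t, s, M, hst.symm, (A.symm t s).trans hM, rfl, rfl⟩

/-- The left complement of `alt s t k i` in an alternating word of length `M`. -/
lemma alt_complement_append {M : ℕ} (k : ℕ) {i : ℕ} (hi : i ≤ M) :
    alt s t (k + (M - i)) (M - i) ++ alt s t k i = alt s t (k + (M - i)) M := by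
  conv_rhs => rw [show M = (M - i) + i by omega, alt_add]
  rw [show M - i + i - i = M - i by omega,
    alt_congr (k := k + (M - i) + (M - i)) (l := k) (by omega)]

lemma step2lStar_alt {A : ArtinData S} {M : ℕ} (hst : s ≠ t) (hM : A.m s t = (M : ℕ∞))
    {w₁ w₂ : Word S} {k i l j : ℕ} (hi : 1 ≤ i) (hi' : i < M) (hj : 1 ≤ j) (hj' : j < M)
    (hpar : (k + i + l + j) % 2 = 1)
    (h₁ : w₁.getLast? ≠ some (letter s t (k + 1), true))
    (h₂ : w₂.head? ≠ some (letter s t (l + 1), false)) :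
    Step2lStar A (w₁ ++ alt s t k i ++ wordInv (alt s t l j) ++ w₂)
      (w₁ ++ wordInv (alt s t (k + (M - i)) (M - i)) ++ alt s t (l + (M - j)) (M - j) ++ w₂) := by
  have last (k : ℕ) {i : ℕ} (hi' : i < M) : (alt s t (k + (M - i)) (M - i)).getLast? =
      some (letter s t (k + 1), true) := by
    rw [getLast?_alt _ (by omega),
      letter_congr (show (k + (M - i) + (M - i) + 1) % 2 = (k + 1) % 2 by omega)]
  refine ⟨w₁, w₂, alt s t k i, _, alt s t l j, _, ?_, alt_ne_nil k hi, alt_ne_nil l hj, rfl, rfl,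
    isLCSuffix_of_getLast? (last k hi') h₁, isLCSuffix_of_getLast? (last l hj') ?_⟩
  · rw [alt_complement_append k hi'.le, alt_complement_append l hj'.le]
    exact isRel_alt hst hM (by omega)
  · rw [getLast?_wordInv]
    contrapose! h₂
    obtain ⟨⟨x, b⟩, hx, hx'⟩ := Option.map_eq_some_iff.1 h₂
    simp only [Prod.mk.injEq] at hx'
    rw [hx, hx'.1]
    simpa using hx'.2

/-! ### Transporting `Δ` through a word -/

/-- `Carry s t M c r r'`: the word `r` splits into maximal alternating signed factors of length
between `1` and `M - 1`, the last one negative, no such factor merges or cancels with a preceding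
positive factor ending in `letter s t c`, and `r'` is the word for `Δ r` obtained by applying `δ`
to every factor but the last, which is replaced by its complement. -/
inductive Carry (s t : S) (M : ℕ) : ℕ → Word S → Word S → Prop
  | last {c k j : ℕ} (hj : 1 ≤ j) (hj' : j < M) (hc : (k + j) % 2 = c % 2) :
      Carry s t M c (wordInv (alt s t k j)) (alt s t (k + (M - j)) (M - j))
  | neg {c k j : ℕ} {r r' : Word S} (hj : 1 ≤ j) (hj' : j < M) (hc : (k + j) % 2 = c % 2)
      (h : Carry s t M (k + 1) r r') :
      Carry s t M c (wordInv (alt s t k j) ++ r) (wordInv (alt s t (k + M) j) ++ r')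
  | pos {c j : ℕ} {r r' : Word S} (hj : 1 ≤ j) (hj' : j < M)
      (h : Carry s t M (c + j + 1) r r') :
      Carry s t M c (alt s t c j ++ r) (alt s t (c + M) j ++ r')

namespace Carry

variable {M : ℕ}

lemma congr {c d : ℕ} {r r' : Word S} (h : Carry s t M c r r') (hcd : c % 2 = d % 2) :
    Carry s t M d r r' := by
  induction h generalizing d with
  | last hj hj' hc => exact .last hj hj' (by omega)
  | neg hj hj' hc h => exact .neg hj hj' (by omega) h
  | @pos c j _ _ hj hj' h ih =>
    rw [alt_congr hcd, alt_congr (show (c + M) % 2 = (d + M) % 2 by omega)]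
    exact .pos hj hj' (ih (by omega))

lemma head?_ne (hst : s ≠ t) {c : ℕ} {r r' : Word S} (h : Carry s t M c r r') :
    r.head? ≠ some (letter s t c, false) := by
  cases h with
  | last hj hj' hc =>
    rw [head?_wordInv_alt _ hj]
    intro h
    have := letter_inj hst (Prod.ext_iff.1 (Option.some.inj h)).1
    omega
  | neg hj hj' hc h =>
    rw [List.head?_append, head?_wordInv_alt _ hj]
    intro h
    have := letter_inj hst (Prod.ext_iff.1 (Option.some.inj h)).1
    omega
  | pos hj hj' h => simp [head?_alt _ hj]

lemma head?_ne' (hst : s ≠ t) {c : ℕ} {r r' : Word S} (h : Carry s t M c r r') :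
    r'.head? ≠ some (letter s t (c + M), false) := by
  cases h with
  | @last _ _ j hj hj' hc => simp [head?_alt _ (show 1 ≤ M - j by omega)]
  | neg hj hj' hc h =>
    rw [List.head?_append, head?_wordInv_alt _ hj]
    intro h
    have := letter_inj hst (Prod.ext_iff.1 (Option.some.inj h)).1
    omega
  | pos hj hj' h => simp [head?_alt _ hj]

/-- A positive alternating factor ending in `letter s t c`, followed by a word that can absorb
`Δ`, is turned by type 2l⋆ transformations into its negative complement followed by the word
having absorbed `Δ`. -/
theorem steps {A : ArtinData S} (hst : s ≠ t) (hM : A.m s t = (M : ℕ∞)) {c : ℕ} {r r' : Word S}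
    (h : Carry s t M c r r') {w₁ : Word S} {k i : ℕ} (hi : 1 ≤ i) (hi' : i < M)
    (hc : (k + i + 1) % 2 = c % 2) (h₁ : w₁.getLast? ≠ some (letter s t (k + 1), true)) :
    Relation.ReflTransGen (Step2lStar A) (w₁ ++ alt s t k i ++ r)
      (w₁ ++ wordInv (alt s t (k + (M - i)) (M - i)) ++ r') := by
  induction h generalizing w₁ k i with
  | @last c l j hj hj' hc' =>
    have := step2lStar_alt hst hM (w₂ := []) (l := l) hi hi' hj hj' (by omega) h₁ (by simp)
    simpa using Relation.ReflTransGen.single this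
  | @neg c l j r r' hj hj' hc' h ih =>
    have first := step2lStar_alt hst hM (w₂ := r) (l := l) hi hi' hj hj' (by omega) h₁
      (h.head?_ne hst)
    have rest := ih (w₁ := w₁ ++ wordInv (alt s t (k + (M - i)) (M - i))) (k := l + (M - j))
      (i := M - j) (by omega) (by omega) (by omega) (by
        rw [List.getLast?_append, getLast?_wordInv, head?_alt _ (by omega)]
        simp)
    rw [show l + (M - j) + (M - (M - j)) = l + M by omega,
      show M - (M - j) = j by omega] at rest
    simp only [List.append_assoc] at first rest ⊢
    exact .head first rest
  | @pos c j r r' hj hj' h ih =>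
    have first := ih (w₁ := w₁ ++ alt s t k i) (k := c) (i := j) hj hj' rfl (by
      rw [List.getLast?_append, getLast?_alt _ hi]
      intro h
      have := letter_inj hst (Prod.ext_iff.1 (Option.some.inj h)).1
      omega)
    have last := step2lStar_alt hst hM (w₁ := w₁) (w₂ := r') (l := c + (M - j)) (j := M - j)
      hi hi' (by omega) (by omega) (by omega) h₁ (by
        rw [letter_congr (show (c + (M - j) + 1) % 2 = (c + j + 1 + M) % 2 by omega)]
        exact h.head?_ne' hst)
    rw [show c + (M - j) + (M - (M - j)) = c + M by omega,
      show M - (M - j) = j by omega] at last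
    simp only [List.append_assoc] at first last ⊢
    exact .tail first last

end Carry

/-! ### The permutation `δ` -/

lemma deltaMap_append (M : ℕ) (u v : Word S) :
    deltaMap s t M (u ++ v) = deltaMap s t M u ++ deltaMap s t M v := by
  unfold deltaMap
  split_ifs <;> simp

lemma deltaMap_reverse (M : ℕ) (u : Word S) :
    deltaMap s t M u.reverse = (deltaMap s t M u).reverse := by
  unfold deltaMap
  split_ifs <;> simp

lemma deltaMap_nil (M : ℕ) : deltaMap s t M [] = [] := by
  unfold deltaMap
  split_ifs <;> rfl

lemma deltaMap_letter (hst : s ≠ t) (M k : ℕ) (b : Bool) :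
    deltaMap s t M [(letter s t k, b)] = [(letter s t (k + M), b)] := by
  unfold deltaMap
  split_ifs with hM
  · rw [Nat.even_iff] at hM
    rw [letter_congr (show k % 2 = (k + M) % 2 by omega)]
  · rw [Nat.even_iff] at hM
    unfold letter
    rcases Nat.mod_two_eq_zero_or_one k with hk | hk
    · simp [hk, show (k + M) % 2 ≠ 0 by omega]
    · simp [hk, show (k + M) % 2 = 0 by omega, hst.symm]

lemma deltaMap_cons_letter (hst : s ≠ t) (M k : ℕ) (b : Bool) (u : Word S) :
    deltaMap s t M ((letter s t k, b) :: u) = (letter s t (k + M), b) :: deltaMap s t M u := by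
  rw [← List.singleton_append, deltaMap_append, deltaMap_letter hst, List.singleton_append]

/-! ### Words with bounded alternating factors -/

/-- `w` is freely reduced, its positive alternating factors have length at most `p`, and its
negative ones length at most `n`. -/
structure AltBounded (s t : S) (p n : ℕ) (w : Word S) : Prop where
  reduced : ∀ (x : S) (b : Bool), ¬ [(x, b), (x, !b)] <:+: w
  pos_le : ∀ k j : ℕ, alt s t k j <:+: w → j ≤ p
  neg_le : ∀ k j : ℕ, wordInv (alt s t k j) <:+: w → j ≤ n

namespace AltBounded

variable {p n M : ℕ}

lemma of_factor {v w : Word S} (h : AltBounded s t p n w) (hv : v <:+: w) : AltBounded s t p n v :=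
  ⟨fun x b h' => h.reduced x b (h'.trans hv), fun k j h' => h.pos_le k j (h'.trans hv),
    fun k j h' => h.neg_le k j (h'.trans hv)⟩

lemma reverse {w : Word S} (h : AltBounded s t p n w) : AltBounded s t p n w.reverse := by
  refine ⟨fun x b h' => ?_, fun k j h' => ?_, fun k j h' => ?_⟩
  · exact h.reduced x (!b) (by simpa using List.reverse_infix.2 h')
  · exact h.pos_le _ j (by simpa [reverse_alt] using List.reverse_infix.2 h')
  · exact h.neg_le _ j (by simpa [reverse_alt, ← wordInv_reverse] using List.reverse_infix.2 h')

lemma parity_of_pos_neg {k i l j : ℕ} {r : Word S} (hi : 1 ≤ i) (hj : 1 ≤ j)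
    (h : AltBounded s t p n (alt s t k i ++ (wordInv (alt s t l j) ++ r))) :
    (k + i + l + j) % 2 = 1 := by
  by_contra hpar
  obtain ⟨i, rfl⟩ := Nat.exists_eq_add_of_le' hi
  obtain ⟨j, rfl⟩ := Nat.exists_eq_add_of_le' hj
  refine h.reduced (letter s t (k + i)) true ⟨alt s t k i, wordInv (alt s t l j) ++ r, ?_⟩
  rw [alt_succ', wordInv_alt_succ, letter_congr (show (l + j) % 2 = (k + i) % 2 by omega)]
  simp

lemma parity_of_neg_neg {k i l : ℕ} (hi : 1 ≤ i)
    (h : AltBounded s t p n (wordInv (alt s t k i) ++ wordInv (alt s t l n))) :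
    (l + n) % 2 = (k + 1) % 2 := by
  by_contra hpar
  have : wordInv (alt s t k i) ++ wordInv (alt s t l n) = wordInv (alt s t l (n + i)) := by
    rw [wordInv_alt_add, alt_congr (k := l + n) (l := k) (by omega)]
  have := h.neg_le l (n + i) (this ▸ List.infix_refl _)
  omega

/-- Adding letters one by one to a first alternating factor and starting a new one whenever
needed, a word with bounded alternating factors is seen to absorb `Δ`. -/
lemma carry_append (hst : s ≠ t) (hdih : ∀ x : S, x = s ∨ x = t) (hn : 1 ≤ n) (hn' : n < M)
    (hp' : p < M) (l : ℕ) (wm : Word S) :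
    (∀ c i : ℕ, 1 ≤ i → AltBounded s t p n (alt s t c i ++ (wm ++ wordInv (alt s t l n))) →
      Carry s t M c (alt s t c i ++ (wm ++ wordInv (alt s t l n)))
        (alt s t (c + M) i ++ (deltaMap s t M wm ++ alt s t (l + (M - n)) (M - n)))) ∧
    (∀ k i : ℕ, 1 ≤ i →
      AltBounded s t p n (wordInv (alt s t k i) ++ (wm ++ wordInv (alt s t l n))) →
      Carry s t M (k + i) (wordInv (alt s t k i) ++ (wm ++ wordInv (alt s t l n)))
        (wordInv (alt s t (k + M) i) ++
          (deltaMap s t M wm ++ alt s t (l + (M - n)) (M - n)))) := by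
  induction wm with
  | nil =>
    simp only [deltaMap_nil, List.nil_append]
    refine ⟨fun c i hi h => ?_, fun k i hi h => ?_⟩
    · have := h.pos_le c i (List.prefix_append _ _).isInfix
      have := parity_of_pos_neg (r := []) hi hn (by simpa using h)
      exact .pos hi (by omega) (.last hn hn' (by omega))
    · have := h.neg_le k i (List.prefix_append _ _).isInfix
      exact .neg hi (by omega) rfl (.last hn hn' (parity_of_neg_neg hi h))
  | cons a wm ih =>
    obtain ⟨x, b⟩ := a
    obtain ⟨ihp, ihn⟩ := ih
    refine ⟨fun c i hi h => ?_, fun k i hi h => ?_⟩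
    · have hip := h.pos_le c i (List.prefix_append _ _).isInfix
      have hsuf := h.of_factor (List.suffix_append _ _).isInfix
      rcases exists_letter hdih x (c + i) with rfl | rfl <;> cases b
      · have := ihn (c + i) 1 le_rfl (by simpa [wordInv_alt_one] using hsuf)
        rw [deltaMap_cons_letter hst]
        simp only [wordInv_alt_one, List.singleton_append] at this
        exact .pos hi (by omega) this
      · have := ihp c (i + 1) (by omega) (by simpa [alt_succ'] using h)
        rw [deltaMap_cons_letter hst]
        rw [alt_succ', alt_succ', show c + M + i = c + i + M by omega] at this
        simpa using this
      · obtain ⟨i, rfl⟩ := Nat.exists_eq_add_of_le' hi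
        refine (h.reduced (letter s t (c + i)) true
          ⟨alt s t c i, wm ++ wordInv (alt s t l n), ?_⟩).elim
        rw [alt_succ', letter_congr (show (c + (i + 1) + 1) % 2 = (c + i) % 2 by omega)]
        simp
      · have := ihp (c + i + 1) 1 le_rfl (by simpa [alt_one] using hsuf)
        rw [deltaMap_cons_letter hst]
        simp only [alt_one, List.singleton_append] at this
        exact .pos hi (by omega) this
    · have hip := h.neg_le k i (List.prefix_append _ _).isInfix
      have hsuf := h.of_factor (List.suffix_append _ _).isInfix
      rcases exists_letter hdih x k with rfl | rfl <;> cases b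
      · have := ihn k 1 le_rfl (by simpa [wordInv_alt_one] using hsuf)
        rw [deltaMap_cons_letter hst]
        simp only [wordInv_alt_one, List.singleton_append] at this
        exact .neg hi (by omega) rfl this
      · obtain ⟨i, rfl⟩ := Nat.exists_eq_add_of_le' hi
        refine (h.reduced (letter s t k) false
          ⟨wordInv (alt s t (k + 1) i), wm ++ wordInv (alt s t l n), ?_⟩).elim
        rw [wordInv_alt_succ']
        simp
      · have := ihn (k + 1) (i + 1) (by omega) (by
          rw [wordInv_alt_succ', alt_congr (show (k + 1 + 1) % 2 = k % 2 by omega)]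
          simpa using h)
        rw [deltaMap_cons_letter hst]
        rw [wordInv_alt_succ', wordInv_alt_succ',
          alt_congr (show (k + 1 + 1) % 2 = k % 2 by omega),
          alt_congr (show (k + 1 + M + 1) % 2 = (k + M) % 2 by omega)] at this
        refine Carry.congr ?_ (show (k + 1 + (i + 1)) % 2 = (k + i) % 2 by omega)
        simpa using this
      · have := ihp (k + 1) 1 le_rfl (by simpa [alt_one] using hsuf)
        rw [deltaMap_cons_letter hst]
        simp only [alt_one, List.singleton_append] at this
        exact .neg hi (by omega) rfl this

lemma carry_of_maximal (hst : s ≠ t) (hdih : ∀ x : S, x = s ∨ x = t) (hp : 1 ≤ p) (hn : 1 ≤ n)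
    (hn' : n < M) (hp' : p < M) {k l : ℕ} {wm : Word S}
    (h : AltBounded s t p n (alt s t k p ++ (wm ++ wordInv (alt s t l n)))) :
    Carry s t M (k + p + 1) (wm ++ wordInv (alt s t l n))
      (deltaMap s t M wm ++ alt s t (l + (M - n)) (M - n)) := by
  have hsuf := h.of_factor (List.suffix_append _ _).isInfix
  cases wm with
  | nil =>
    rw [deltaMap_nil]
    have := parity_of_pos_neg (r := []) hp hn (by simpa using h)
    exact .last hn hn' (by omega)
  | cons a wm =>
    obtain ⟨x, b⟩ := a
    obtain ⟨carry_pos, carry_neg⟩ := carry_append hst hdih hn hn' hp' l wm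
    rcases exists_letter hdih x (k + p) with rfl | rfl <;> cases b
    · have := carry_neg (k + p) 1 le_rfl (by simpa [wordInv_alt_one] using hsuf)
      rw [deltaMap_cons_letter hst]
      simpa only [wordInv_alt_one, List.nil_append, List.cons_append] using this
    · have := h.pos_le k (p + 1) (by
        rw [alt_succ']
        exact ⟨[], wm ++ wordInv (alt s t l n), by simp⟩)
      omega
    · obtain ⟨p, rfl⟩ := Nat.exists_eq_add_of_le' hp
      refine (h.reduced (letter s t (k + p)) true
        ⟨alt s t k p, wm ++ wordInv (alt s t l n), ?_⟩).elim
      rw [alt_succ', letter_congr (show (k + (p + 1) + 1) % 2 = (k + p) % 2 by omega)]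
      simp
    · have := carry_pos (k + p + 1) 1 le_rfl (by simpa [alt_one] using hsuf)
      rw [deltaMap_cons_letter hst]
      simpa only [alt_one, List.nil_append, List.cons_append] using this

theorem steps2l {A : ArtinData S} (hst : s ≠ t) (hdih : ∀ x : S, x = s ∨ x = t)
    (hM : A.m s t = (M : ℕ∞)) (hp : 1 ≤ p) (hn : 1 ≤ n) (hpn : p + n = M) {k l : ℕ} {wm : Word S}
    (h : AltBounded s t p n (alt s t k p ++ wm ++ wordInv (alt s t l n))) :
    Relation.ReflTransGen (Step2lStar A) (alt s t k p ++ wm ++ wordInv (alt s t l n))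
      (wordInv (alt s t (k + n) n) ++ deltaMap s t M wm ++ alt s t (l + p) p) := by
  rw [List.append_assoc] at h
  have := (h.carry_of_maximal hst hdih hp hn (M := M) (by omega) (by omega)).steps hst hM
    (w₁ := []) (k := k) hp (by omega) rfl (by simp)
  rw [show M - p = n by omega, show M - n = p by omega] at this
  simpa using this

end AltBounded

lemma le_ptilde {v w : Word S} (hv : v <:+: w) (hpos : Positive v) (hsf : SquareFree v) :
    v.length ≤ ptilde w :=
  le_csSup ⟨w.length, fun _ ⟨_, hu, _, _, h⟩ => h ▸ hu.length_le⟩ ⟨v, hv, hpos, hsf, rfl⟩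

lemma le_ntilde {v w : Word S} (hv : v <:+: w) (hneg : Negative v)
    (hsf : SquareFree (wordInv v)) : v.length ≤ ntilde w :=
  le_csSup ⟨w.length, fun _ ⟨_, hu, _, _, h⟩ => h ▸ hu.length_le⟩ ⟨v, hv, hneg, hsf, rfl⟩

lemma squareFree_singleton (a : S × Bool) : SquareFree [a] := by
  intro b h
  have := h.length_le
  simp at this

lemma one_le_ptilde {w : Word S} (hw : ¬ Negative w) : 1 ≤ ptilde w := by
  simp only [Negative, not_forall, Bool.not_eq_false] at hw
  obtain ⟨a, ha, hb⟩ := hw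
  exact le_ptilde (v := [a]) (List.singleton_infix_iff a w |>.2 ha) (by simpa [Positive] using hb)
    (squareFree_singleton a)

lemma one_le_ntilde {w : Word S} (hw : ¬ Positive w) : 1 ≤ ntilde w := by
  simp only [Positive, not_forall, Bool.not_eq_true] at hw
  obtain ⟨a, ha, hb⟩ := hw
  exact le_ntilde (v := [a]) (List.singleton_infix_iff a w |>.2 ha) (by simpa [Negative] using hb)
    (squareFree_singleton _)

lemma altBounded_of_freelyReduced (hst : s ≠ t) {w : Word S} (hw : FreelyReduced w) :
    AltBounded s t (ptilde w) (ntilde w) w := by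
  refine ⟨fun x b ⟨u, v, h⟩ => hw u v x b h.symm, fun k j h => ?_, fun k j h => ?_⟩
  · simpa [length_alt] using le_ptilde h (positive_alt k j) (squareFree_alt hst k j)
  · simpa [length_wordInv, length_alt] using le_ntilde h (negative_wordInv (positive_alt k j))
      (by rw [wordInv_wordInv]; exact squareFree_alt hst k j)

lemma exists_alt_of_pair_eq {x y : S} (h : ({x, y} : Set S) = {s, t}) :
    ∃ k : ℕ, ∀ j : ℕ, altWord x y j = alt s t k j ∧ altWordR x y j = alt s t (k + j) j := by
  obtain ⟨k, rfl, rfl⟩ : ∃ k : ℕ, x = letter s t k ∧ y = letter s t (k + 1) := by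
    rcases Set.pair_eq_pair_iff.1 h with ⟨rfl, rfl⟩ | ⟨rfl, rfl⟩
    · exact ⟨0, rfl, rfl⟩
    · exact ⟨1, rfl, rfl⟩
  refine ⟨k, fun j => ⟨rfl, ?_⟩⟩
  have : altWord (letter s t (k + 1)) (letter s t k) j = alt s t (k + 1) j := by
    rw [alt, letter_congr (show (k + 1 + 1) % 2 = k % 2 by omega)]
  rw [altWordR, this, reverse_alt, alt_congr (show (k + 1 + j + 1) % 2 = (k + j) % 2 by omega)]

/-- Lemma 2.15: in a dihedral Artin–Tits group with `m < ∞`, for every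
unsigned critical word `w` one has `w →_{2⋆} τ(w)`. -/
theorem stmt6 {S : Type*} [Finite S] (A : ArtinData S) (s t : S) (M : ℕ)
    (hst : s ≠ t) (hdih : ∀ x : S, x = s ∨ x = t) (hM : A.m s t = (M : ℕ∞))
    (w w' : Word S) (h : UCritTauPair A s t M w w') :
    Steps2Star A w w' := by
  obtain ⟨-, hred, ⟨hnp, hnn⟩, -, hpn, x, y, z, z', wm, hxy, hzz, hw⟩ := h
  have hpt := one_le_ptilde hnn
  have hnt := one_le_ntilde hnp
  have hM2 : 2 ≤ M := by
    have := A.two_le s t hst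
    rw [hM] at this
    exact_mod_cast this
  have bound := altBounded_of_freelyReduced hst hred
  have hp : pfun M w = ptilde w := by unfold pfun nfun at *; omega
  have hn : nfun M w = ntilde w := by unfold pfun nfun at *; omega
  rw [hp, hn] at hpn hw
  obtain ⟨k, hk⟩ := exists_alt_of_pair_eq hxy
  obtain ⟨l, hl⟩ := exists_alt_of_pair_eq hzz
  generalize ptilde w = p at *
  generalize ntilde w = n at *
  rcases hw with ⟨rfl, rfl⟩ | ⟨rfl, rfl⟩
  · rw [(hk p).1, (hl n).1] at bound ⊢
    rw [(hk n).2, (hl p).2]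
    exact (bound.steps2l hst hdih hM hpt hnt hpn).lift id (p := Step2Star A)
      fun _ _ h => Or.inr h
  · rw [(hk n).2, (hl p).2] at bound ⊢
    rw [(hk p).1, (hl n).1]
    have rev := bound.reverse
    simp only [List.reverse_append, ← wordInv_reverse, reverse_alt, ← List.append_assoc] at rev
    have steps := (rev.steps2l hst hdih hM hpt hnt hpn).lift List.reverse
      (p := Step2Star A) fun _ _ h => Or.inl h.reverse
    simp only [Function.onFun, List.reverse_append, ← wordInv_reverse, reverse_alt,
      ← deltaMap_reverse, List.reverse_reverse, ← List.append_assoc] at steps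
    rwa [alt_congr (show (k + n + n + 1 + n + 1) % 2 = (k + n) % 2 by omega),
      alt_congr (show (l + p + p + 1 + p + 1) % 2 = (l + p) % 2 by omega),
      alt_congr (show (k + n + n + 1 + p + p + 1) % 2 = k % 2 by omega),
      alt_congr (show (l + p + p + 1 + n + n + 1) % 2 = l % 2 by omega)] at steps

end ArtinTits
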